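/- Fix n ≥ 3 and let Q be the subposet of the face poset of the Whitehouse complex Δ_{n+1} (faces ordered by inclusion, including the empty face) consisting of all faces of the form A(F), B(F), C(F,S), or D(F,S) for F a face of Δ_n and S ∈ F; equivalently, Q is the lower order ideal of faces of Δ_{n+1} containing no vertex of the form {i, n+1}. Let M be the matching on Q consisting of the pairs {A(F), B(F)} for all faces F of Δ_n and {C(F,S), D(F,S)} for all pairs (F,S) with S ∈ F. Then every pair of M is a cover relation in the face poset, M is a perfect matching of Q (every element of Q is matched), and M is a Morse matching: the directed graph on Q obtained by orienting all cover edges of Q downwards and then reversing the edges of M is acyclic. -/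

import Mathlib

/-- `F` is a face of the Whitehouse complex `Δ_n`. -/
def IsWhFace (n : ℕ) (F : Finset (Finset ℕ)) : Prop :=
  (∀ S ∈ F, S ⊆ Finset.Icc 2 n ∧ 2 ≤ S.card ∧ S.card ≤ n - 2) ∧
  ∀ S ∈ F, ∀ T ∈ F, S ⊆ T ∨ T ⊆ S ∨ S ∩ T = ∅

/-- `A(F) = F`. -/
def mapA (F : Finset (Finset ℕ)) : Finset (Finset ℕ) := F

/-- `B(F) = F ∪ {{2,…,n}}`. -/
def mapB (n : ℕ) (F : Finset (Finset ℕ)) : Finset (Finset ℕ) :=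
  insert (Finset.Icc 2 n) F

/-- `C(F,S) = {T ∪ {n+1} : T ∈ F, S ⊆ T} ∪ {T : T ∈ F, S ⊄ T}`. -/
def mapC (n : ℕ) (F : Finset (Finset ℕ)) (S : Finset ℕ) : Finset (Finset ℕ) :=
  (F.filter (fun T => S ⊆ T)).image (insert (n + 1)) ∪ F.filter (fun T => ¬ S ⊆ T)

/-- `D(F,S) = C(F,S) ∪ {S}`. -/
def mapD (n : ℕ) (F : Finset (Finset ℕ)) (S : Finset ℕ) : Finset (Finset ℕ) :=
  insert S (mapC n F S)

/-- The subposet `Q` of the face poset of `Δ_{n+1}`: the faces containing no vertex of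
the form `{j, n+1}`. -/
def whQ (n : ℕ) : Set (Finset (Finset ℕ)) :=
  {G | IsWhFace (n + 1) G ∧ ∀ j : ℕ, ({j, n + 1} : Finset ℕ) ∉ G}

/-- The matching on `Q`: `x` is matched upwards with `y` iff `(x,y) = (A(F), B(F))` for
some face `F` of `Δ_n`, or `(x,y) = (C(F,S), D(F,S))` for some face `F` and `S ∈ F`. -/
def whM (n : ℕ) (x y : Finset (Finset ℕ)) : Prop :=
  ∃ F : Finset (Finset ℕ), IsWhFace n F ∧
    ((x = mapA F ∧ y = mapB n F) ∨ ∃ S ∈ F, x = mapC n F S ∧ y = mapD n F S)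

/-- The elements of `{2,…,n}` lying in every member of `G` that contains `n + 1`. In the matching,
`G` is paired with the face obtained by adding or removing this set. -/
def toggleSet (n : ℕ) (G : Finset (Finset ℕ)) : Finset ℕ :=
  (Finset.Icc 2 n).filter (fun i => ∀ U ∈ G, n + 1 ∈ U → i ∈ U)

theorem notMem_toggleSet (n : ℕ) (G : Finset (Finset ℕ)) : n + 1 ∉ toggleSet n G := by
  simp [toggleSet]

theorem toggleSet_anti (n : ℕ) {G G' : Finset (Finset ℕ)} (h : G ⊆ G') :
    toggleSet n G' ⊆ toggleSet n G := by
  intro i hi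
  simp only [toggleSet, Finset.mem_filter] at hi ⊢
  exact ⟨hi.1, fun U hU => hi.2 U (h hU)⟩

theorem toggleSet_insert (n : ℕ) (G : Finset (Finset ℕ)) {S : Finset ℕ} (hS : n + 1 ∉ S) :
    toggleSet n (insert S G) = toggleSet n G := by
  ext i
  simp only [toggleSet, Finset.mem_filter, Finset.mem_insert]
  grind

theorem IsWhFace.mono {n : ℕ} {F G : Finset (Finset ℕ)} (hG : IsWhFace n G) (h : F ⊆ G) :
    IsWhFace n F :=
  ⟨fun S hS => hG.1 S (h hS), fun S hS T hT => hG.2 S (h hS) T (h hT)⟩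

theorem mem_whQ_of_subset {n : ℕ} {F G : Finset (Finset ℕ)} (hG : G ∈ whQ n) (h : F ⊆ G) :
    F ∈ whQ n :=
  ⟨hG.1.mono h, fun j hj => hG.2 j (h hj)⟩

theorem IsWhFace.notMem_of_mem {n : ℕ} {F : Finset (Finset ℕ)} (hF : IsWhFace n F)
    {S : Finset ℕ} (hS : S ∈ F) : n + 1 ∉ S := by
  intro h
  have := (hF.1 S hS).1 h
  simp at this

theorem IsWhFace.Icc_notMem {n : ℕ} (hn : 3 ≤ n) {F : Finset (Finset ℕ)} (hF : IsWhFace n F) :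
    Finset.Icc 2 n ∉ F := by
  intro h
  have := (hF.1 _ h).2.2
  simp at this
  omega

theorem mem_mapC {n : ℕ} {F : Finset (Finset ℕ)} {S T : Finset ℕ} :
    T ∈ mapC n F S ↔ (∃ V ∈ F, S ⊆ V ∧ insert (n + 1) V = T) ∨ (T ∈ F ∧ ¬ S ⊆ T) := by
  simp [mapC, and_assoc]

theorem toggleSet_eq_Icc {n : ℕ} {F : Finset (Finset ℕ)} (hF : ∀ S ∈ F, n + 1 ∉ S) :
    toggleSet n F = Finset.Icc 2 n := by
  ext i
  simp only [toggleSet, Finset.mem_filter]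
  exact ⟨fun h => h.1, fun h => ⟨h, fun U hU h1 => absurd h1 (hF U hU)⟩⟩

theorem toggleSet_mapC {n : ℕ} {F : Finset (Finset ℕ)} (hF : IsWhFace n F) {S : Finset ℕ}
    (hS : S ∈ F) : toggleSet n (mapC n F S) = S := by
  ext i
  simp only [toggleSet, Finset.mem_filter]
  constructor
  · rintro ⟨hi, h⟩
    have := h (insert (n + 1) S) (mem_mapC.2 (Or.inl ⟨S, hS, subset_rfl, rfl⟩)) (by simp)
    rcases Finset.mem_insert.1 this with rfl | h'
    · simp at hi
    · exact h'
  · intro hi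
    refine ⟨(hF.1 S hS).1 hi, fun U hU hU1 => ?_⟩
    rcases mem_mapC.1 hU with ⟨V, -, hSV, rfl⟩ | ⟨hUF, -⟩
    · exact Finset.mem_insert_of_mem (hSV hi)
    · exact absurd hU1 (hF.notMem_of_mem hUF)

theorem notMem_mapC {n : ℕ} {F : Finset (Finset ℕ)} (hF : IsWhFace n F) {S : Finset ℕ}
    (hS : S ∈ F) : S ∉ mapC n F S := by
  intro h
  rcases mem_mapC.1 h with ⟨V, -, -, hV⟩ | ⟨-, h⟩
  · exact hF.notMem_of_mem hS (hV ▸ Finset.mem_insert_self _ _)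
  · exact h subset_rfl

theorem mapB_mem_whQ {n : ℕ} (hn : 3 ≤ n) {F : Finset (Finset ℕ)} (hF : IsWhFace n F) :
    mapB n F ∈ whQ n := by
  have hsub : ∀ S ∈ mapB n F, S ⊆ Finset.Icc 2 n := by
    intro S hS
    rcases Finset.mem_insert.1 hS with rfl | hS
    · rfl
    · exact (hF.1 S hS).1
  refine ⟨⟨fun S hS => ⟨(hsub S hS).trans (Finset.Icc_subset_Icc_right (by omega)), ?_⟩, ?_⟩, ?_⟩
  · rcases Finset.mem_insert.1 hS with rfl | hS
    · simp; omega
    · have := (hF.1 S hS).2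
      omega
  · intro S hS T hT
    rcases Finset.mem_insert.1 hS with rfl | hS'
    · exact Or.inr (Or.inl (hsub T hT))
    · rcases Finset.mem_insert.1 hT with rfl | hT'
      · exact Or.inl (hsub S hS)
      · exact hF.2 S hS' T hT'
  · intro j hj
    have : n + 1 ∈ Finset.Icc 2 n := hsub _ hj (by simp)
    simp at this

theorem mapD_mem_whQ {n : ℕ} (hn : 3 ≤ n) {F : Finset (Finset ℕ)} (hF : IsWhFace n F)
    {S : Finset ℕ} (hS : S ∈ F) : mapD n F S ∈ whQ n := by
  have key : ∀ T ∈ mapD n F S,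
      (∃ V ∈ F, S ⊆ V ∧ insert (n + 1) V = T) ∨ (T ∈ F ∧ (S ⊆ T → S = T)) := by
    intro T hT
    rcases Finset.mem_insert.1 hT with rfl | hT
    · exact Or.inr ⟨hS, fun _ => rfl⟩
    · rcases mem_mapC.1 hT with h | ⟨h, h'⟩
      · exact Or.inl h
      · exact Or.inr ⟨h, fun h'' => absurd h'' h'⟩
  have hIcc : Finset.Icc 2 n ⊆ Finset.Icc 2 (n + 1) := Finset.Icc_subset_Icc_right (by omega)
  have hSne : S.Nonempty := Finset.card_pos.1 (by have := (hF.1 S hS).2; omega)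
  have mixed : ∀ V ∈ F, S ⊆ V → ∀ T ∈ F, (S ⊆ T → S = T) →
      T ⊆ insert (n + 1) V ∨ insert (n + 1) V ∩ T = ∅ := by
    intro V hV hSV T hT hST
    rcases hF.2 V hV T hT with h | h | h
    · left
      rw [← hST (hSV.trans h)]
      exact hSV.trans (Finset.subset_insert _ _)
    · exact Or.inl (h.trans (Finset.subset_insert _ _))
    · right
      rw [Finset.insert_inter_of_notMem (hF.notMem_of_mem hT), h]
  refine ⟨⟨fun T hT => ?_, fun T hT T' hT' => ?_⟩, fun j hj => ?_⟩
  · rcases key T hT with ⟨V, hV, -, rfl⟩ | ⟨hT, -⟩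
    · obtain ⟨h1, h2, h3⟩ := hF.1 V hV
      rw [Finset.card_insert_of_notMem (hF.notMem_of_mem hV)]
      refine ⟨Finset.insert_subset (by simp; omega) (h1.trans hIcc), by omega, by omega⟩
    · obtain ⟨h1, h2, h3⟩ := hF.1 T hT
      exact ⟨h1.trans hIcc, h2, by omega⟩
  · rcases key T hT with ⟨V, hV, hSV, rfl⟩ | ⟨hT, hST⟩ <;>
      rcases key T' hT' with ⟨V', hV', hSV', rfl⟩ | ⟨hT', hST'⟩
    · rcases hF.2 V hV V' hV' with h | h | h
      · exact Or.inl (Finset.insert_subset_insert _ h)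
      · exact Or.inr (Or.inl (Finset.insert_subset_insert _ h))
      · exact absurd (Finset.subset_empty.1 (h ▸ Finset.subset_inter hSV hSV')) hSne.ne_empty
    · exact Or.inr (mixed V hV hSV T' hT' hST')
    · rcases mixed V' hV' hSV' T hT hST with h | h
      · exact Or.inl h
      · exact Or.inr (Or.inr (by rwa [Finset.inter_comm]))
    · exact hF.2 T hT T' hT'
  · rcases key _ hj with ⟨V, hV, -, h⟩ | ⟨hT, -⟩
    · have h1 := congrArg Finset.card h
      rw [Finset.card_insert_of_notMem (hF.notMem_of_mem hV)] at h1
      have h2 := Finset.card_le_two (a := j) (b := n + 1)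
      have h3 := (hF.1 V hV).2.1
      omega
    · exact hF.notMem_of_mem hT (by simp)

theorem whM.spec {n : ℕ} (hn : 3 ≤ n) {x y : Finset (Finset ℕ)} (h : whM n x y) :
    y ∈ whQ n ∧ toggleSet n x ∉ x ∧ y = insert (toggleSet n x) x := by
  obtain ⟨F, hF, ⟨rfl, rfl⟩ | ⟨S, hS, rfl, rfl⟩⟩ := h
  · rw [toggleSet_eq_Icc fun S hS => hF.notMem_of_mem hS]
    exact ⟨mapB_mem_whQ hn hF, hF.Icc_notMem hn, rfl⟩
  · rw [toggleSet_mapC hF hS]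
    exact ⟨mapD_mem_whQ hn hF hS, notMem_mapC hF hS, rfl⟩

theorem three_le_card_of_mem_whQ {n : ℕ} {x : Finset (Finset ℕ)} (hx : x ∈ whQ n)
    {V : Finset ℕ} (hV : V ∈ x) (hnV : n + 1 ∈ V) : 3 ≤ V.card := by
  have h2 := (hx.1.1 V hV).2.1
  by_contra hlt
  have h1 : (V.erase (n + 1)).card = 1 := by
    rw [Finset.card_erase_of_mem hnV]
    omega
  obtain ⟨j, hj⟩ := Finset.card_eq_one.1 h1
  refine hx.2 j ?_
  rwa [Finset.pair_comm, ← hj, Finset.insert_erase hnV]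

theorem erase_subset_Icc {n : ℕ} {V : Finset ℕ} (hV : V ⊆ Finset.Icc 2 (n + 1)) :
    V.erase (n + 1) ⊆ Finset.Icc 2 n := by
  intro i hi
  have h1 := Finset.ne_of_mem_erase hi
  have h2 := Finset.mem_Icc.1 (hV (Finset.mem_of_mem_erase hi))
  rw [Finset.mem_Icc]
  omega

theorem isWhFace_image_erase {n : ℕ} {x : Finset (Finset ℕ)}
    (hx : x ∈ whQ n) {U : Finset ℕ} (hU : U ∈ x) (hnU : n + 1 ∈ U) :
    IsWhFace n (x.image fun V => V.erase (n + 1)) := by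
  have hUc := (hx.1.1 U hU).2.2
  have hU3 := three_le_card_of_mem_whQ hx hU hnU
  have hUe := Finset.card_erase_of_mem hnU
  refine ⟨fun T hT => ?_, fun T hT T' hT' => ?_⟩
  · obtain ⟨V, hV, rfl⟩ := Finset.mem_image.1 hT
    obtain ⟨h1, h2, h3⟩ := hx.1.1 V hV
    have hsub := erase_subset_Icc h1
    refine ⟨hsub, ?_⟩
    by_cases hnV : n + 1 ∈ V
    · have := three_le_card_of_mem_whQ hx hV hnV
      rw [Finset.card_erase_of_mem hnV]
      omega
    · rw [Finset.erase_eq_of_notMem hnV] at hsub ⊢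
      refine ⟨h2, ?_⟩
      rcases hx.1.2 V hV U hU with h | h | h
      · have := Finset.card_le_card (Finset.subset_erase.2 ⟨h, hnV⟩)
        omega
      · exact absurd (h hnU) hnV
      · have hd : Disjoint V (U.erase (n + 1)) :=
          (Finset.disjoint_iff_inter_eq_empty.2 h).mono_right (Finset.erase_subset _ _)
        have := Finset.card_le_card
          (Finset.union_subset hsub (erase_subset_Icc (hx.1.1 U hU).1))
        rw [Finset.card_union_of_disjoint hd, Nat.card_Icc] at this
        omega
  · obtain ⟨V, hV, rfl⟩ := Finset.mem_image.1 hT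
    obtain ⟨V', hV', rfl⟩ := Finset.mem_image.1 hT'
    rcases hx.1.2 V hV V' hV' with h | h | h
    · exact Or.inl (Finset.erase_subset_erase _ h)
    · exact Or.inr (Or.inl (Finset.erase_subset_erase _ h))
    · right; right
      rw [← Finset.subset_empty, ← h]
      exact Finset.inter_subset_inter (Finset.erase_subset _ _) (Finset.erase_subset _ _)

theorem whM_insert_toggleSet {n : ℕ} {x : Finset (Finset ℕ)}
    (hx : x ∈ whQ n) (ht : toggleSet n x ∉ x) : whM n x (insert (toggleSet n x) x) := by
  by_cases hex : ∃ V ∈ x, n + 1 ∈ V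
  · obtain ⟨V, hV, hnV⟩ := hex
    obtain ⟨U, hU, hmin⟩ := (x.filter (n + 1 ∈ ·)).exists_min_image Finset.card
      ⟨V, Finset.mem_filter.2 ⟨hV, hnV⟩⟩
    obtain ⟨hU, hnU⟩ := Finset.mem_filter.1 hU
    have hUle : ∀ W ∈ x, n + 1 ∈ W → U ⊆ W := by
      intro W hW hnW
      rcases hx.1.2 U hU W hW with h | h | h
      · exact h
      · exact (Finset.eq_of_subset_of_card_le h (hmin W (Finset.mem_filter.2 ⟨hW, hnW⟩))).ge
      · exact absurd (Finset.mem_inter.2 ⟨hnU, hnW⟩) (by simp [h])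
    have hF := isWhFace_image_erase hx hU hnU
    have hS : U.erase (n + 1) ∈ x.image fun V => V.erase (n + 1) :=
      Finset.mem_image_of_mem _ hU
    have htU : toggleSet n x = U.erase (n + 1) := by
      ext i
      simp only [toggleSet, Finset.mem_filter]
      refine ⟨fun ⟨hi, h⟩ => Finset.mem_erase.2 ⟨?_, h U hU hnU⟩,
        fun hi => ⟨(hF.1 _ hS).1 hi, fun W hW hnW => hUle W hW hnW (Finset.mem_of_mem_erase hi)⟩⟩
      rintro rfl
      simp at hi
    rw [htU] at ht ⊢
    have hxC : x = mapC n (x.image fun V => V.erase (n + 1)) (U.erase (n + 1)) := by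
      ext T
      rw [mem_mapC]
      constructor
      · intro hT
        by_cases hnT : n + 1 ∈ T
        · exact Or.inl ⟨_, Finset.mem_image_of_mem _ hT,
            Finset.erase_subset_erase _ (hUle T hT hnT), Finset.insert_erase hnT⟩
        · refine Or.inr ⟨Finset.mem_image.2 ⟨T, hT, Finset.erase_eq_of_notMem hnT⟩, fun hsub => ?_⟩
          rcases hx.1.2 T hT U hU with h | h | h
          · exact ht ((hsub.antisymm (Finset.subset_erase.2 ⟨h, hnT⟩)) ▸ hT)
          · exact hnT (h hnU)
          · have h2 := (hF.1 _ hS).2.1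
            have h3 := Finset.card_le_card
              (Finset.subset_inter hsub (Finset.erase_subset (n + 1) U))
            rw [h, Finset.card_empty] at h3
            omega
      · rintro (⟨V, hV, hsub, rfl⟩ | ⟨hT, hsub⟩)
        · obtain ⟨W, hW, rfl⟩ := Finset.mem_image.1 hV
          by_cases hnW : n + 1 ∈ W
          · rwa [Finset.insert_erase hnW]
          · rw [Finset.erase_eq_of_notMem hnW] at hsub ⊢
            rcases hx.1.2 W hW U hU with h | h | h
            · exact absurd ((hsub.antisymm (Finset.subset_erase.2 ⟨h, hnW⟩)) ▸ hW) ht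
            · exact absurd (h hnU) hnW
            · have h2 := (hF.1 _ hS).2.1
              have h3 := Finset.card_le_card
                (Finset.subset_inter hsub (Finset.erase_subset (n + 1) U))
              rw [h, Finset.card_empty] at h3
              omega
        · obtain ⟨W, hW, rfl⟩ := Finset.mem_image.1 hT
          by_cases hnW : n + 1 ∈ W
          · exact absurd (Finset.erase_subset_erase _ (hUle W hW hnW)) hsub
          · rwa [Finset.erase_eq_of_notMem hnW]
    exact ⟨_, hF, Or.inr ⟨_, hS, hxC, congrArg (insert (U.erase (n + 1))) hxC⟩⟩
  · push Not at hex
    rw [toggleSet_eq_Icc hex] at ht ⊢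
    refine ⟨x, ⟨fun S hS => ?_, hx.1.2⟩, Or.inl ⟨rfl, rfl⟩⟩
    obtain ⟨h1, h2, h3⟩ := hx.1.1 S hS
    have hsub := erase_subset_Icc h1
    rw [Finset.erase_eq_of_notMem (hex S hS)] at hsub
    refine ⟨hsub, h2, ?_⟩
    have hlt := Finset.card_lt_card
      (Finset.ssubset_iff_subset_ne.2 ⟨hsub, fun h => ht (h ▸ hS)⟩)
    rw [Nat.card_Icc] at hlt
    omega

theorem whM_iff {n : ℕ} (hn : 3 ≤ n) {x y : Finset (Finset ℕ)} :
    whM n x y ↔ x ∈ whQ n ∧ toggleSet n x ∉ x ∧ y = insert (toggleSet n x) x := by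
  constructor
  · intro h
    obtain ⟨h1, h2, h3⟩ := h.spec hn
    exact ⟨mem_whQ_of_subset h1 (h3 ▸ Finset.subset_insert _ _), h2, h3⟩
  · rintro ⟨h1, h2, rfl⟩
    exact whM_insert_toggleSet h1 h2

theorem whM.toggleSet_eq {n : ℕ} (hn : 3 ≤ n) {x y : Finset (Finset ℕ)} (h : whM n x y) :
    toggleSet n y = toggleSet n x := by
  rw [(h.spec hn).2.2, toggleSet_insert n x (notMem_toggleSet n x)]

theorem exists_whM {n : ℕ} {G : Finset (Finset ℕ)} (hG : G ∈ whQ n) :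
    ∃ x y : Finset (Finset ℕ), whM n x y ∧ (G = x ∨ G = y) := by
  by_cases ht : toggleSet n G ∈ G
  · have hte : toggleSet n (G.erase (toggleSet n G)) = toggleSet n G := by
      rw [← toggleSet_insert n (G.erase (toggleSet n G)) (notMem_toggleSet n G),
        Finset.insert_erase ht]
    have h := whM_insert_toggleSet (mem_whQ_of_subset hG (Finset.erase_subset (toggleSet n G) G))
      (by rw [hte]; exact Finset.notMem_erase _ _)
    rw [hte, Finset.insert_erase ht] at h
    exact ⟨_, _, h, Or.inr rfl⟩
  · exact ⟨_, _, whM_insert_toggleSet hG ht, Or.inl rfl⟩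

/-- A potential that strictly increases along the edges of the directed graph of the matching. -/
def whPotential (n : ℕ) (x : Finset (Finset ℕ)) : ℕ ×ₗ ℕ ×ₗ ℕᵒᵈ :=
  toLex ((toggleSet n x).card,
    toLex (if toggleSet n x ∈ x then 1 else 0, OrderDual.toDual x.card))

theorem whPotential_lt_of_whM {n : ℕ} (hn : 3 ≤ n) {x y : Finset (Finset ℕ)} (h : whM n x y) :
    whPotential n x < whPotential n y := by
  obtain ⟨-, h2, h3⟩ := h.spec hn
  have hy : toggleSet n x ∈ y := h3 ▸ Finset.mem_insert_self _ _
  simp [whPotential, Prod.Lex.toLex_lt_toLex, h.toggleSet_eq hn, h2, hy]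

theorem whPotential_lt_of_not_whM {n : ℕ} {x y : Finset (Finset ℕ)}
    (hy : y ∈ whQ n) (hyx : y ⊆ x) (hc : x.card = y.card + 1) (h : ¬ whM n y x) :
    whPotential n x < whPotential n y := by
  rcases (toggleSet_anti n hyx).eq_or_ssubset with heq | hss
  · have hiff : toggleSet n y ∈ x ↔ toggleSet n y ∈ y := by
      refine ⟨fun hx => ?_, fun h' => hyx h'⟩
      by_contra hny
      have hins : insert (toggleSet n y) y = x :=
        Finset.eq_of_subset_of_card_le (Finset.insert_subset hx hyx)
          (by rw [Finset.card_insert_of_notMem hny, hc])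
      exact h (hins ▸ whM_insert_toggleSet hy hny)
    simp [whPotential, Prod.Lex.toLex_lt_toLex, heq, hiff]
    omega
  · exact Prod.Lex.toLex_lt_toLex.2 (Or.inl (Finset.card_lt_card hss))

theorem stmt11 (n : ℕ) (hn : 3 ≤ n) :
    -- `Q` consists exactly of the faces of the form `A(F)`, `B(F)`, `C(F,S)`, `D(F,S)`
    (∀ G : Finset (Finset ℕ), G ∈ whQ n ↔
      ∃ F : Finset (Finset ℕ), IsWhFace n F ∧
        (G = mapA F ∨ G = mapB n F ∨ ∃ S ∈ F, G = mapC n F S ∨ G = mapD n F S)) ∧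
    -- `Q` is a lower order ideal of the face poset of `Δ_{n+1}`
    (∀ G G' : Finset (Finset ℕ), IsWhFace (n + 1) G → G' ∈ whQ n → G ⊆ G' →
      G ∈ whQ n) ∧
    -- every matched pair lies in `Q` and is a cover relation of the face poset
    (∀ x y : Finset (Finset ℕ), whM n x y →
      x ∈ whQ n ∧ y ∈ whQ n ∧ x ⊆ y ∧ y.card = x.card + 1) ∧
    -- the pairs are pairwise disjoint (`whM` is a matching)
    (∀ x y x' y' : Finset (Finset ℕ), whM n x y → whM n x' y' →
      (x = x' ∧ y = y') ∨ (x ≠ x' ∧ x ≠ y' ∧ y ≠ x' ∧ y ≠ y')) ∧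
    -- the matching is perfect: every element of `Q` is matched
    (∀ G ∈ whQ n, ∃ x y : Finset (Finset ℕ), whM n x y ∧ (G = x ∨ G = y)) ∧
    -- and it is a Morse matching: the directed graph on `Q` obtained by orienting all
    -- cover edges downwards and reversing the matched edges is acyclic
    (¬ ∃ x : Finset (Finset ℕ), Relation.TransGen
      (fun x y => x ∈ whQ n ∧ y ∈ whQ n ∧
        ((y ⊆ x ∧ x.card = y.card + 1 ∧ ¬ whM n y x) ∨
         (x ⊆ y ∧ y.card = x.card + 1 ∧ whM n x y))) x x) := by
  have hQ : ∀ x y : Finset (Finset ℕ), whM n x y →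
      x ∈ whQ n ∧ y ∈ whQ n ∧ x ⊆ y ∧ y.card = x.card + 1 := by
    intro x y h
    obtain ⟨h1, h2, h3⟩ := h.spec hn
    exact ⟨((whM_iff hn).1 h).1, h1, h3 ▸ Finset.subset_insert _ _,
      h3 ▸ Finset.card_insert_of_notMem h2⟩
  refine ⟨fun G => ⟨fun hG => ?_, ?_⟩, fun G G' _ hG' h => mem_whQ_of_subset hG' h, hQ, ?_,
    fun G hG => exists_whM hG, ?_⟩
  · obtain ⟨x, y, ⟨F, hF, ⟨rfl, rfl⟩ | ⟨S, hS, rfl, rfl⟩⟩, h⟩ := exists_whM hG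
    · exact ⟨_, hF, h.imp_right Or.inl⟩
    · exact ⟨F, hF, Or.inr (Or.inr ⟨S, hS, h⟩)⟩
  · rintro ⟨F, hF, h | h | ⟨S, hS, h | h⟩⟩
    · exact h ▸ (hQ _ _ ⟨F, hF, Or.inl ⟨rfl, rfl⟩⟩).1
    · exact h ▸ mapB_mem_whQ hn hF
    · exact h ▸ (hQ _ _ ⟨F, hF, Or.inr ⟨S, hS, rfl, rfl⟩⟩).1
    · exact h ▸ mapD_mem_whQ hn hF hS
  · intro x y x' y' h h'
    have ht := h.toggleSet_eq hn
    have ht' := h'.toggleSet_eq hn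
    obtain ⟨-, h2, h3⟩ := h.spec hn
    obtain ⟨-, h2', h3'⟩ := h'.spec hn
    by_cases hxx : x = x'
    · subst hxx
      exact Or.inl ⟨rfl, h3.trans h3'.symm⟩
    · have hy : toggleSet n x ∈ y := h3 ▸ Finset.mem_insert_self _ _
      have hy' : toggleSet n x' ∈ y' := h3' ▸ Finset.mem_insert_self _ _
      refine Or.inr ⟨hxx, ?_, ?_, ?_⟩
      · rintro rfl
        exact h2 (ht' ▸ hy')
      · rintro rfl
        exact h2' (ht ▸ hy)
      · rintro rfl
        apply hxx
        rw [← Finset.erase_insert h2, ← Finset.erase_insert h2', ← h3, ← h3', ← ht, ← ht']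
  · rintro ⟨x, hx⟩
    refine lt_irrefl (whPotential n x) (Relation.TransGen.trans_induction_on
      (motive := fun {a b} _ => whPotential n a < whPotential n b) hx ?_
      (fun _ _ h1 h2 => h1.trans h2))
    rintro a b ⟨-, hb, ⟨hs, hc, hm⟩ | ⟨-, -, hm⟩⟩
    · exact whPotential_lt_of_not_whM hb hs hc hm
    · exact whPotential_lt_of_whM hn hm
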